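/- arXiv:1705.02066 — 3 statements merged into one kernel-verified Lean document; each statement's English description precedes it below -/
import Mathlib

section
/- Let q > 3 be odd. Then a strongly regular graph with parameters v = (q + 1)(q² − q + 1), k = q(q² + 1)/2, λ = (q − 1)(q² + 3)/4, μ = (q + 1)(q² + 1)/4 (equivalently, with eigenvalues e⁺ = (q − 1)/2 and e⁻ = −(q² + 1)/2) contains at most two cocliques of size q² − q + 1 (i.e., at most two Delsarte cocliques). -/
/-- `Y` is a coclique (independent set) in the graph `G`. -/
def IsCoclique {V : Type*} (G : SimpleGraph V) (Y : Finset V) : Prop :=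
  ∀ x ∈ Y, ∀ y ∈ Y, ¬ G.Adj x y

namespace SimpleGraph

open Finset

section Indicator

variable {V : Type*} (G : SimpleGraph V) [DecidableRel G.Adj]

/-- The integer entry of the adjacency matrix at `x`, `y`. -/
def adjIndicator (x y : V) : ℤ :=
  if G.Adj x y then 1 else 0

theorem adjIndicator_comm (x y : V) : G.adjIndicator x y = G.adjIndicator y x := by
  simp [adjIndicator, G.adj_comm]

/-- The number of neighbours of `x` in `S`, as an integer. -/
def nbrsIn (S : Finset V) (x : V) : ℤ :=
  ∑ y ∈ S, G.adjIndicator x y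

variable {G}

theorem nbrsIn_eq_zero {S : Finset V} (hS : IsCoclique G S) {x : V} (hx : x ∈ S) :
    G.nbrsIn S x = 0 :=
  sum_eq_zero fun y hy => by simp [adjIndicator, hS x hx y hy]

theorem card_filter_adj (S : Finset V) (x : V) : (#{y ∈ S | G.Adj x y} : ℤ) = G.nbrsIn S x := by
  simp [nbrsIn, adjIndicator]

end Indicator

/-- If a sum of squares over the whole type is already attained on `Y`, the summands outside `Y`
vanish. -/
theorem eq_zero_of_sum_sq_le {V : Type*} [Fintype V] [DecidableEq V] {f : V → ℤ} {Y : Finset V}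
    (hf : ∑ x, f x ^ 2 ≤ ∑ x ∈ Y, f x ^ 2) {x : V} (hx : x ∉ Y) : f x = 0 := by
  rw [← sum_add_sum_compl Y] at hf
  have h₁ : f x ^ 2 ≤ ∑ x ∈ Yᶜ, f x ^ 2 :=
    single_le_sum (fun i _ => sq_nonneg (f i)) (mem_compl.2 hx)
  have h₂ : f x ^ 2 = 0 := le_antisymm (by linarith) (sq_nonneg _)
  exact pow_eq_zero_iff two_ne_zero |>.1 h₂

namespace IsSRGWith

variable {V : Type*} [Fintype V] {G : SimpleGraph V} [DecidableRel G.Adj]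
  {n k l m : ℕ}

theorem sum_adjIndicator (h : G.IsSRGWith n k l m) (x : V) : ∑ z, G.adjIndicator z x = k := by
  have := h.regular x
  simp [adjIndicator, G.adj_comm _ x, ← this, ← card_neighborFinset_eq_degree,
    neighborFinset_eq_filter]

theorem sum_nbrsIn (h : G.IsSRGWith n k l m) (S : Finset V) :
    ∑ x, G.nbrsIn S x = #S * k := by
  simp only [nbrsIn]
  rw [sum_comm]
  simp [h.sum_adjIndicator]

variable [DecidableEq V]

theorem sum_adjIndicator_mul (h : G.IsSRGWith n k l m) (x y : V) :
    ∑ z, G.adjIndicator z x * G.adjIndicator z y =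
      if x = y then (k : ℤ) else if G.Adj x y then (l : ℤ) else m := by
  have key : ∑ z, G.adjIndicator z x * G.adjIndicator z y =
      Fintype.card (G.commonNeighbors x y) := by
    simp only [adjIndicator, G.adj_comm _ x, G.adj_comm _ y, ← ite_and, mul_ite, mul_one,
      mul_zero, Finset.sum_boole]
    rw [← Set.toFinset_card]
    congr 2
    ext z
    simp [mem_commonNeighbors, and_comm]
  split_ifs with h₁ h₂
  · subst h₁
    rw [← h.sum_adjIndicator x]
    refine sum_congr rfl fun z _ => ?_
    simp [adjIndicator]
  · rw [key, h.of_adj x y h₂]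
  · rw [key, h.of_not_adj h₁ h₂]

theorem sum_nbrsIn_sq (h : G.IsSRGWith n k l m) {S : Finset V} (hS : IsCoclique G S) :
    ∑ x, G.nbrsIn S x ^ 2 = #S ^ 2 * m + #S * (k - m) := by
  have h₁ : ∑ x, G.nbrsIn S x ^ 2 =
      ∑ y ∈ S, ∑ z ∈ S, ∑ x, G.adjIndicator x y * G.adjIndicator x z := by
    simp only [nbrsIn, sq, sum_mul_sum]
    rw [sum_comm]
    exact sum_congr rfl fun y _ => sum_comm
  have h₂ : ∀ y ∈ S, ∑ z ∈ S, ∑ x, G.adjIndicator x y * G.adjIndicator x z =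
      #S * m + (k - m) := fun y hy => by
    have : ∀ z ∈ S, ∑ x, G.adjIndicator x y * G.adjIndicator x z =
        m + if y = z then (k - m : ℤ) else 0 := fun z hz => by
      rw [h.sum_adjIndicator_mul, if_neg (hS y hy z hz)]
      split_ifs <;> ring
    rw [sum_congr rfl this, sum_add_distrib, sum_ite_eq, if_pos hy]
    simp
  rw [h₁, sum_congr rfl h₂]
  simp
  ring

theorem sum_nbrsIn_mul (h : G.IsSRGWith n k l m) {S : Finset V} {x : V}
    (hS : ∀ y ∈ S, G.Adj x y) :
    ∑ z, G.nbrsIn S z * G.adjIndicator z x = #S * l := by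
  simp only [nbrsIn, sum_mul]
  rw [sum_comm]
  have : ∀ y ∈ S, ∑ z, G.adjIndicator z y * G.adjIndicator z x = l := fun y hy => by
    rw [h.sum_adjIndicator_mul, if_neg (hS y hy).ne', if_pos (hS y hy).symm]
  rw [sum_congr rfl this]
  simp

variable {a : ℕ}

/-- A vertex outside a Delsarte coclique of the Taylor graph with `q = 2 * a + 1` has
`2 * a ^ 2 + 2 * a + 1` neighbours in it. -/
theorem nbrsIn_delsarte
    (h : G.IsSRGWith ((2 * a + 2) * (4 * a ^ 2 + 2 * a + 1)) ((2 * a + 1) * (2 * a ^ 2 + 2 * a + 1))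
      (2 * a * (a ^ 2 + a + 1)) ((a + 1) * (2 * a ^ 2 + 2 * a + 1)))
    {Y : Finset V} (hY : IsCoclique G Y) (hc : #Y = 4 * a ^ 2 + 2 * a + 1) {x : V} (hx : x ∉ Y) :
    G.nbrsIn Y x = 2 * a ^ 2 + 2 * a + 1 := by
  have h₀ := h.card
  have h₁ := h.sum_nbrsIn Y
  have h₂ := h.sum_nbrsIn_sq hY
  rw [hc] at h₁ h₂
  push_cast at h₁ h₂
  have h₃ : ∑ x ∈ Y, (G.nbrsIn Y x - (2 * a ^ 2 + 2 * a + 1 : ℤ)) ^ 2 =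
      (4 * a ^ 2 + 2 * a + 1 : ℤ) * (2 * a ^ 2 + 2 * a + 1) ^ 2 := by
    rw [sum_congr rfl fun x hx => by rw [nbrsIn_eq_zero hY hx], sum_const, hc]
    push_cast [nsmul_eq_mul]
    ring
  refine sub_eq_zero.1 (eq_zero_of_sum_sq_le
    (f := fun x => G.nbrsIn Y x - (2 * a ^ 2 + 2 * a + 1)) (le_of_eq ?_) hx)
  rw [h₃]
  simp only [sub_sq, sum_add_distrib, sum_sub_distrib, h₂, ← sum_mul, ← mul_sum, h₁, sum_const,
    card_univ, h₀]
  simp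
  ring

/-- Two nonadjacent vertices outside a Delsarte coclique of the Taylor graph with `q = 2 * a + 1`
have `(a + 1) ^ 2` common neighbours in it. -/
theorem nbrsIn_filter_delsarte
    (h : G.IsSRGWith ((2 * a + 2) * (4 * a ^ 2 + 2 * a + 1)) ((2 * a + 1) * (2 * a ^ 2 + 2 * a + 1))
      (2 * a * (a ^ 2 + a + 1)) ((a + 1) * (2 * a ^ 2 + 2 * a + 1)))
    {Y : Finset V} (hY : IsCoclique G Y) (hc : #Y = 4 * a ^ 2 + 2 * a + 1) {x z : V} (hx : x ∉ Y)
    (hz : z ∉ Y) (hxz : z ≠ x) (hadj : ¬ G.Adj z x) :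
    G.nbrsIn {y ∈ Y | G.Adj x y} z = (a + 1) ^ 2 := by
  set S : Finset V := {y ∈ Y | G.Adj x y}
  have hSY : S ⊆ Y := filter_subset _ _
  have hSx : ∀ y ∈ S, G.Adj x y := fun y hy => (mem_filter.1 hy).2
  have hS : IsCoclique G S := fun y hy z hz => hY y (hSY hy) z (hSY hz)
  have hd := h.nbrsIn_delsarte hY hc hx
  have hSc : (#S : ℤ) = 2 * a ^ 2 + 2 * a + 1 := by rw [card_filter_adj, hd]
  have h₀ := h.card
  have h₁ := h.sum_nbrsIn S
  have h₂ := h.sum_nbrsIn_sq hS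
  have h₃ := h.sum_nbrsIn_mul hSx
  rw [hSc] at h₁ h₂ h₃
  push_cast at h₁ h₂ h₃
  have h₄ := h.sum_adjIndicator x
  push_cast at h₄
  have hLx : G.nbrsIn S x = 2 * a ^ 2 + 2 * a + 1 := by
    rw [← hSc]
    simp only [nbrsIn]
    rw [sum_congr rfl fun y hy => by rw [adjIndicator, if_pos (hSx y hy)]]
    simp
  have hsq : ∀ w, G.adjIndicator w x ^ 2 = G.adjIndicator w x := fun w => by
    simp [adjIndicator]
  have hYx : ∑ w ∈ Y, G.adjIndicator w x = 2 * a ^ 2 + 2 * a + 1 := by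
    rw [← hd]
    exact sum_congr rfl fun w _ => by simp [adjIndicator, G.adj_comm]
  let f : V → ℤ := fun w =>
    G.nbrsIn S w + a * G.adjIndicator w x - (a + 1) ^ 2 - if w = x then (a : ℤ) ^ 2 else 0
  have hfY : ∑ w ∈ Y, f w ^ 2 = (a ^ 2 - 2 * a * (a + 1) ^ 2) * (2 * a ^ 2 + 2 * a + 1) +
      (4 * a ^ 2 + 2 * a + 1) * (a + 1) ^ 4 := by
    have : ∀ w ∈ Y, f w ^ 2 =
        (a ^ 2 - 2 * a * (a + 1) ^ 2) * G.adjIndicator w x + (a + 1) ^ 4 := fun w hw => by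
      have h₅ : G.nbrsIn S w = 0 := sum_eq_zero fun y hy => by
        simp [adjIndicator, hY w hw y (hSY hy)]
      have h₆ : w ≠ x := fun e => hx (e ▸ hw)
      simp only [f, h₅, if_neg h₆]
      linear_combination (a : ℤ) ^ 2 * hsq w
    rw [sum_congr rfl this, sum_add_distrib, ← mul_sum, hYx, sum_const, hc]
    simp
  have hfV : ∑ w, f w ^ 2 = ∑ w ∈ Y, f w ^ 2 := by
    have : ∀ w, f w ^ 2 = G.nbrsIn S w ^ 2 + 2 * a * (G.nbrsIn S w * G.adjIndicator w x)
        - 2 * (a + 1) ^ 2 * G.nbrsIn S w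
        + (a ^ 2 - 2 * a * (a + 1) ^ 2) * G.adjIndicator w x + (a + 1) ^ 4
        + if w = x then (a : ℤ) ^ 4 + 2 * a ^ 2 * (a + 1) ^ 2
            - 2 * a ^ 2 * (2 * a ^ 2 + 2 * a + 1) else 0 := fun w => by
      simp only [f]
      split_ifs with e
      · subst e
        have h₅ : G.adjIndicator w w = 0 := by simp [adjIndicator]
        rw [h₅, hLx]
        ring
      · linear_combination (a : ℤ) ^ 2 * hsq w
    rw [hfY, sum_congr rfl fun w _ => this w]
    simp only [sum_add_distrib, sum_sub_distrib, ← mul_sum, h₁, h₂, h₃, h₄, sum_const, card_univ,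
      h₀, sum_ite_eq', mem_univ, if_true]
    simp
    ring
  have hfz := eq_zero_of_sum_sq_le hfV.le hz
  simp only [f, adjIndicator, if_neg hxz, if_neg hadj] at hfz
  linarith

/-- A Taylor graph with `q = 2 * a + 1 > 3` has at most one Delsarte coclique. -/
theorem delsarte_coclique_unique
    (h : G.IsSRGWith ((2 * a + 2) * (4 * a ^ 2 + 2 * a + 1)) ((2 * a + 1) * (2 * a ^ 2 + 2 * a + 1))
      (2 * a * (a ^ 2 + a + 1)) ((a + 1) * (2 * a ^ 2 + 2 * a + 1))) (ha : 1 < a)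
    {Y Z : Finset V} (hY : IsCoclique G Y) (hYc : #Y = 4 * a ^ 2 + 2 * a + 1)
    (hZ : IsCoclique G Z) (hZc : #Z = 4 * a ^ 2 + 2 * a + 1) : Y = Z := by
  by_contra hne
  obtain ⟨x, hxZ, hxY⟩ : ∃ x ∈ Z, x ∉ Y := by
    by_contra! hsub
    exact hne (eq_of_subset_of_card_le hsub (by omega)).symm
  have hx : x ∈ Z \ Y := mem_sdiff.2 ⟨hxZ, hxY⟩
  set S : Finset V := {y ∈ Y | G.Adj x y}
  have hSc : (#S : ℤ) = 2 * a ^ 2 + 2 * a + 1 := by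
    rw [card_filter_adj, h.nbrsIn_delsarte hY hYc hxY]
  have hcol : ∑ z ∈ Z \ Y, G.nbrsIn S z = (2 * a ^ 2 + 2 * a + 1) ^ 2 := by
    simp only [nbrsIn]
    rw [sum_comm]
    have : ∀ y ∈ S, ∑ z ∈ Z \ Y, G.adjIndicator z y = 2 * a ^ 2 + 2 * a + 1 := fun y hy => by
      obtain ⟨hyY, hxy⟩ := mem_filter.1 hy
      have hyZ : y ∉ Z := fun hyZ => hZ x hxZ y hyZ hxy
      rw [← h.nbrsIn_delsarte hZ hZc hyZ, nbrsIn]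
      rw [sum_congr rfl fun z _ => by rw [G.adjIndicator_comm]]
      refine sum_subset sdiff_subset fun z hz hz' => ?_
      have hzY : z ∈ Y := by simpa [hz] using hz'
      simp [adjIndicator, hY y hyY z hzY]
    rw [sum_congr rfl this, sum_const, nsmul_eq_mul, hSc]
    ring
  have hrow : ∑ z ∈ Z \ Y, G.nbrsIn S z =
      2 * a ^ 2 + 2 * a + 1 + #((Z \ Y).erase x) * (a + 1) ^ 2 := by
    rw [← add_sum_erase _ _ hx]
    congr 1
    · rw [← hSc, nbrsIn, sum_congr rfl fun y hy => by
        rw [adjIndicator, if_pos (mem_filter.1 hy).2]]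
      simp
    · rw [sum_congr rfl fun z hz => ?_, sum_const, nsmul_eq_mul]
      obtain ⟨hzx, hz⟩ := mem_erase.1 hz
      obtain ⟨hzZ, hzY⟩ := mem_sdiff.1 hz
      exact h.nbrsIn_filter_delsarte hY hYc hxY hzY hzx (hZ z hzZ x hxZ)
  rw [hcol] at hrow
  have hdvd : ((a : ℤ) + 1) ∣ 2 := by
    refine ⟨4 * a ^ 2 + 2 - #((Z \ Y).erase x), ?_⟩
    refine mul_left_cancel₀ (show (a : ℤ) + 1 ≠ 0 by positivity) ?_
    linear_combination -hrow
  have := Int.le_of_dvd two_pos hdvd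
  omega

end IsSRGWith

end SimpleGraph

theorem taylor_graph_at_most_two_delsarte_cocliques {V : Type*} [Fintype V] [DecidableEq V]
    (G : SimpleGraph V) [DecidableRel G.Adj] (q k l m : ℕ) (hq : 3 < q) (hodd : Odd q)
    (hk : 2 * k = q * (q ^ 2 + 1)) (hl : 4 * l = (q - 1) * (q ^ 2 + 3))
    (hm : 4 * m = (q + 1) * (q ^ 2 + 1))
    (hsrg : G.IsSRGWith ((q + 1) * (q ^ 2 - q + 1)) k l m) :
    {Y : Finset V | IsCoclique G Y ∧ Y.card = q ^ 2 - q + 1}.ncard ≤ 2 := by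
  obtain ⟨a, rfl⟩ := hodd
  have hn : (2 * a + 1) ^ 2 - (2 * a + 1) + 1 = 4 * a ^ 2 + 2 * a + 1 := by
    rw [show (2 * a + 1) ^ 2 = 4 * a ^ 2 + 2 * a + (2 * a + 1) by ring, Nat.add_sub_cancel]
  obtain rfl : k = (2 * a + 1) * (2 * a ^ 2 + 2 * a + 1) := by linarith
  obtain rfl : l = 2 * a * (a ^ 2 + a + 1) := by
    rw [Nat.add_sub_cancel] at hl
    linarith
  obtain rfl : m = (a + 1) * (2 * a ^ 2 + 2 * a + 1) := by linarith
  rw [hn] at hsrg ⊢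
  refine le_trans ((Set.ncard_le_one_iff (Set.toFinite _)).2 fun hY hZ => ?_) one_le_two
  exact hsrg.delsarte_coclique_unique (by omega) hY.1 hY.2 hZ.1 hZ.2
end

section
/- Let q > 3 be odd and let Γ be a strongly regular graph with parameters v = (q + 1)(q² − q + 1), k = q(q² + 1)/2, λ = (q − 1)(q² + 3)/4, μ = (q + 1)(q² + 1)/4 (equivalently, with eigenvalues e⁺ = (q − 1)/2 and e⁻ = −(q² + 1)/2). If the automorphism group of Γ acts transitively on the vertices of Γ, then Γ contains no coclique of size q² − q + 1 (i.e., no Delsarte coclique). In particular, Taylor's 2-graph for U(3, q) (which has a transitive automorphism group) does not possess a Delsarte coclique. -/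
open Finset

/-- The Seidel matrix of `G` (with `-1` for adjacent and `1` for non-adjacent vertices),
shifted by `q` times the identity. -/
def shiftedSeidel {V : Type*} [DecidableEq V] (G : SimpleGraph V) [DecidableRel G.Adj] (q : ℤ)
    (x y : V) : ℤ :=
  if x = y then q else if G.Adj x y then -1 else 1

lemma sum_sq_sum_mul {V : Type*} [Fintype V] {M : V → V → ℤ} {c : ℤ} (hcomm : ∀ x y, M x y = M y x)
    (hM : ∀ x w, ∑ y, M x y * M y w = c * M x w) (u : V → ℤ) :
    ∑ x, (∑ y, u y * M y x) ^ 2 = c * ∑ x, u x * ∑ y, u y * M y x := by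
  have h : ∀ x, (∑ y, u y * M y x) ^ 2 = ∑ y, ∑ z, u y * u z * (M y x * M x z) := by
    intro x
    rw [pow_two, sum_mul_sum]
    refine sum_congr rfl fun y _ => sum_congr rfl fun z _ => ?_
    rw [hcomm x z]
    ring
  simp only [h]
  rw [sum_comm, mul_sum]
  refine sum_congr rfl fun y _ => ?_
  rw [sum_comm, mul_sum, mul_sum]
  refine sum_congr rfl fun z _ => ?_
  rw [← mul_sum, hM, hcomm y z]
  ring

section

variable {V : Type*} [DecidableEq V] (G : SimpleGraph V) [DecidableRel G.Adj]

lemma shiftedSeidel_self (q : ℤ) (x : V) : shiftedSeidel G q x x = q := by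
  simp [shiftedSeidel]

lemma shiftedSeidel_comm (q : ℤ) (x y : V) :
    shiftedSeidel G q x y = shiftedSeidel G q y x := by
  simp [shiftedSeidel, eq_comm, G.adj_comm]

lemma shiftedSeidel_of_not_adj (q : ℤ) {x y : V} (hne : x ≠ y) (h : ¬ G.Adj x y) :
    shiftedSeidel G q x y = 1 := by
  simp [shiftedSeidel, hne, h]

lemma shiftedSeidel_mul_self_of_ne (q : ℤ) {x y : V} (hne : x ≠ y) :
    shiftedSeidel G q x y * shiftedSeidel G q x y = 1 := by
  unfold shiftedSeidel
  split_ifs <;> simp_all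

lemma shiftedSeidel_eq_adjMatrix (q : ℤ) (x y : V) :
    shiftedSeidel G q x y =
      1 + (q - 1) * (1 : Matrix V V ℤ) x y - 2 * G.adjMatrix ℤ x y := by
  unfold shiftedSeidel
  rw [Matrix.one_apply, SimpleGraph.adjMatrix_apply]
  by_cases hxy : x = y
  · subst hxy
    simp
  · by_cases h : G.Adj x y <;> simp [hxy, h]

variable {G}

/-- The row sum of the shifted Seidel matrix over a coclique, at a vertex of the coclique. -/
lemma IsCoclique.sum_shiftedSeidel_of_mem {Y : Finset V} (hY : IsCoclique G Y) (q : ℤ)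
    {x : V} (hx : x ∈ Y) : ∑ y ∈ Y, shiftedSeidel G q x y = q - 1 + #Y := by
  have h : ∀ y ∈ Y, shiftedSeidel G q x y = (if x = y then q - 1 else 0) + 1 := by
    intro y hy
    by_cases hxy : x = y
    · simp [hxy, shiftedSeidel_self]
    · simp [hxy, shiftedSeidel_of_not_adj G q hxy (hY x hx y hy)]
  rw [sum_congr rfl h, sum_add_distrib, sum_ite_eq, if_pos hx]
  simp

variable [Fintype V]

lemma sum_shiftedSeidel {k : ℕ} (hG : G.IsRegularOfDegree k) (q : ℤ) (x : V) :
    ∑ y, shiftedSeidel G q x y = Fintype.card V + (q - 1) - 2 * k := by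
  simp only [shiftedSeidel_eq_adjMatrix, sum_sub_distrib, sum_add_distrib, ← mul_sum]
  have h1 : ∑ y, (1 : Matrix V V ℤ) x y = 1 := by simp [Matrix.one_apply]
  have h2 : ∑ y, G.adjMatrix ℤ x y = k := by
    simp [SimpleGraph.adjMatrix_apply, ← hG x, ← SimpleGraph.card_neighborFinset_eq_degree,
      SimpleGraph.neighborFinset_eq_filter]
  rw [h1, h2]
  simp

lemma sum_shiftedSeidel_mul {v k l m : ℕ} {q : ℤ} (hsrg : G.IsSRGWith v k l m)
    (hv : (v : ℤ) = q ^ 3 + 1) (hk : 2 * (k : ℤ) = q * (q ^ 2 + 1))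
    (hl : 4 * (l : ℤ) = (q - 1) * (q ^ 2 + 3)) (hm : 4 * (m : ℤ) = (q + 1) * (q ^ 2 + 1))
    (x w : V) :
    ∑ y, shiftedSeidel G q x y * shiftedSeidel G q y w =
      (q ^ 2 + q) * shiftedSeidel G q x w := by
  have hA := congrFun (congrFun (hsrg.matrix_eq (α := ℤ)) x) w
  rw [pow_two, Matrix.mul_apply] at hA
  have hs := sum_shiftedSeidel hsrg.regular q x
  have hc : ∀ y, shiftedSeidel G q x y * shiftedSeidel G q y w =
      shiftedSeidel G q x y + (q - 1) * (shiftedSeidel G q x y * (1 : Matrix V V ℤ) y w)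
      - 2 * (G.adjMatrix ℤ y w + (q - 1) * ((1 : Matrix V V ℤ) x y * G.adjMatrix ℤ y w)
        - 2 * (G.adjMatrix ℤ x y * G.adjMatrix ℤ y w)) := by
    intro y
    rw [shiftedSeidel_eq_adjMatrix G q y w, shiftedSeidel_eq_adjMatrix G q x y]
    ring
  have h1 : ∑ y, shiftedSeidel G q x y * (1 : Matrix V V ℤ) y w = shiftedSeidel G q x w := by
    simp [Matrix.one_apply]
  have h2 : ∑ y, (1 : Matrix V V ℤ) x y * G.adjMatrix ℤ y w = G.adjMatrix ℤ x w := by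
    simp [Matrix.one_apply, -SimpleGraph.adjMatrix_apply]
  have h3 : ∑ y, G.adjMatrix ℤ y w = k := by
    simp [G.adj_comm _ w, ← hsrg.regular w, ← SimpleGraph.card_neighborFinset_eq_degree,
      SimpleGraph.neighborFinset_eq_filter]
  rw [sum_congr rfl fun y _ => hc y]
  simp only [sum_sub_distrib, sum_add_distrib, ← mul_sum]
  rw [h1, h2, h3, hA, hs, hsrg.card, hv]
  simp only [Matrix.add_apply, Matrix.smul_apply, SimpleGraph.adjMatrix_apply,
    SimpleGraph.compl_adj, Matrix.one_apply, shiftedSeidel]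
  by_cases hxw : x = w
  · subst hxw
    simp
    ring
  · by_cases h : G.Adj x w
    · simp [hxw, h]
      linear_combination hl - 2 * hk
    · simp [hxw, h]
      linear_combination hm - 2 * hk

/-- Equality in the Hoffman bound: every vertex outside a Delsarte coclique has the same number of
neighbours in it. -/
lemma IsCoclique.sum_shiftedSeidel_of_notMem {q : ℤ} {Y : Finset V} (hY : IsCoclique G Y)
    (hcard : (#Y : ℤ) = q ^ 2 - q + 1) (hV : (Fintype.card V : ℤ) = q ^ 3 + 1)
    (hrow : ∀ x, ∑ y, shiftedSeidel G q x y = 0)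
    (hsq : ∀ x w, ∑ y, shiftedSeidel G q x y * shiftedSeidel G q y w =
      (q ^ 2 + q) * shiftedSeidel G q x w) {z : V} (hz : z ∉ Y) :
    ∑ y ∈ Y, shiftedSeidel G q z y = -q := by
  set g : V → ℤ := fun x => ∑ y ∈ Y, shiftedSeidel G q x y with hg
  have hgY : ∀ x ∈ Y, g x = q ^ 2 := fun x hx => by
    rw [hg]
    simp only
    rw [hY.sum_shiftedSeidel_of_mem q hx, hcard]
    ring
  have hsum : ∑ x, g x = 0 := by
    simp only [hg]
    rw [sum_comm]
    refine sum_eq_zero fun y _ => ?_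
    rw [← hrow y]
    exact sum_congr rfl fun x _ => shiftedSeidel_comm G q x y
  have hsqg : ∑ x, g x ^ 2 = (q ^ 2 + q) * ∑ x ∈ Y, g x := by
    have h := sum_sq_sum_mul (shiftedSeidel_comm G q) hsq fun x => if x ∈ Y then 1 else 0
    have hu : ∀ x, ∑ y, (if y ∈ Y then 1 else 0) * shiftedSeidel G q y x = g x := by
      intro x
      simp [hg, shiftedSeidel_comm G q x]
    simp only [hu] at h
    simpa using h
  have hYsum : ∑ x ∈ Y, g x = #Y * q ^ 2 := by
    rw [sum_congr rfl hgY]; simp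
  have hYsq : ∑ x ∈ Y, (g x + q) ^ 2 = #Y * (q ^ 2 + q) ^ 2 := by
    rw [sum_congr rfl fun x hx => by rw [hgY x hx]]; simp
  have hall : ∑ x, (g x + q) ^ 2 = #Y * (q ^ 2 + q) ^ 2 := by
    simp only [add_sq, sum_add_distrib, ← sum_mul, ← mul_sum]
    rw [hsqg, hYsum, hsum]
    simp only [sum_const, card_univ, nsmul_eq_mul, hV, hcard]
    ring
  have hout : ∑ x ∈ Yᶜ, (g x + q) ^ 2 = 0 := by
    have := sum_add_sum_compl Y fun x => (g x + q) ^ 2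
    linarith
  have := (sum_eq_zero_iff_of_nonneg fun x _ => sq_nonneg (g x + q)).1 hout z (by simpa using hz)
  have := pow_eq_zero_iff (two_ne_zero) |>.1 this
  change g z = -q
  linarith

/-- A column of the shifted Seidel matrix outside a Delsarte coclique is a linear combination of
the columns in the coclique. -/
lemma IsCoclique.shiftedSeidel_eq_sum {q : ℤ} {Y : Finset V} (hY : IsCoclique G Y)
    (hcard : (#Y : ℤ) = q ^ 2 - q + 1)
    (hsq : ∀ x w, ∑ y, shiftedSeidel G q x y * shiftedSeidel G q y w =
      (q ^ 2 + q) * shiftedSeidel G q x w) {z : V} (hz : z ∉ Y)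
    (hzY : ∑ y ∈ Y, shiftedSeidel G q z y = -q) (w : V) :
    q * (q - 1) * shiftedSeidel G q z w =
      ∑ y ∈ Y, (q * shiftedSeidel G q z y + 1) * shiftedSeidel G q y w := by
  set f : V → ℤ := fun x => q * (q - 1) * shiftedSeidel G q z x -
    ∑ y ∈ Y, (q * shiftedSeidel G q z y + 1) * shiftedSeidel G q y x with hf
  set u : V → ℤ := fun x => (if x = z then q * (q - 1) else 0) -
    (if x ∈ Y then q * shiftedSeidel G q z x + 1 else 0) with hu
  have hsum : ∀ F : V → ℤ, ∑ x, u x * F x = q * (q - 1) * F z -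
      ∑ y ∈ Y, (q * shiftedSeidel G q z y + 1) * F y := by
    intro F
    simp [hu, sub_mul, sum_sub_distrib]
  have hfz : f z = 0 := by
    have h : ∀ y ∈ Y, (q * shiftedSeidel G q z y + 1) * shiftedSeidel G q y z =
        q + shiftedSeidel G q z y := by
      intro y hy
      have := shiftedSeidel_mul_self_of_ne G q (x := z) (y := y) (fun h => hz (h ▸ hy))
      rw [shiftedSeidel_comm G q y z]
      linear_combination q * this
    simp only [hf]
    rw [sum_congr rfl h, sum_add_distrib, hzY, shiftedSeidel_self]
    simp only [sum_const, nsmul_eq_mul, hcard]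
    ring
  have hfY : ∀ x ∈ Y, f x = 0 := by
    intro x hx
    have h : ∀ y ∈ Y, (q * shiftedSeidel G q z y + 1) * shiftedSeidel G q y x =
        (if y = x then (q - 1) * (q * shiftedSeidel G q z x + 1) else 0) +
          (q * shiftedSeidel G q z y + 1) := by
      intro y hy
      by_cases hyx : y = x
      · simp only [hyx, shiftedSeidel_self, if_true]
        ring
      · simp [hyx, shiftedSeidel_of_not_adj G q hyx (hY y hy x hx)]
    simp only [hf]
    rw [sum_congr rfl h, sum_add_distrib, sum_add_distrib, ← mul_sum, hzY, sum_ite_eq', if_pos hx]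
    simp only [sum_const, nsmul_eq_mul, hcard]
    ring
  have hnorm : ∑ x, f x ^ 2 = 0 := by
    have h := sum_sq_sum_mul (shiftedSeidel_comm G q) hsq u
    have hfx : ∀ x, ∑ y, u y * shiftedSeidel G q y x = f x := fun x => hsum _
    simp only [hfx] at h
    rw [h, hsum, hfz, sum_eq_zero fun y hy => by rw [hfY y hy, mul_zero]]
    ring
  have := (sum_eq_zero_iff_of_nonneg fun x _ => sq_nonneg (f x)).1 hnorm w (mem_univ w)
  have := pow_eq_zero_iff (two_ne_zero) |>.1 this
  simp only [hf] at this
  linarith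

/-- The size of the intersection of two distinct Delsarte cocliques. -/
lemma IsCoclique.card_inter_mul {q : ℤ} (hq : 0 < q) {Y Z : Finset V} (hY : IsCoclique G Y)
    (hZ : IsCoclique G Z) (hYcard : (#Y : ℤ) = q ^ 2 - q + 1)
    (hZcard : (#Z : ℤ) = q ^ 2 - q + 1) (hV : (Fintype.card V : ℤ) = q ^ 3 + 1)
    (hrow : ∀ x, ∑ y, shiftedSeidel G q x y = 0)
    (hsq : ∀ x w, ∑ y, shiftedSeidel G q x y * shiftedSeidel G q y w =
      (q ^ 2 + q) * shiftedSeidel G q x w) {z : V} (hzZ : z ∈ Z) (hzY : z ∉ Y) :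
    (#(Y ∩ Z) : ℤ) * (q + 1) = (q - 1) ^ 2 := by
  have hzs := hY.sum_shiftedSeidel_of_notMem hYcard hV hrow hsq hzY
  have h := sum_congr (rfl : Z = Z) fun w _ => hY.shiftedSeidel_eq_sum hYcard hsq hzY hzs w
  rw [← mul_sum, hZ.sum_shiftedSeidel_of_mem q hzZ, sum_comm] at h
  have hr : ∀ y ∈ Y, ∑ w ∈ Z, (q * shiftedSeidel G q z y + 1) * shiftedSeidel G q y w =
      -q * (q * shiftedSeidel G q z y + 1) + if y ∈ Z then q * (q + 1) ^ 2 else 0 := by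
    intro y hy
    rw [← mul_sum]
    by_cases hyZ : y ∈ Z
    · rw [hZ.sum_shiftedSeidel_of_mem q hyZ, if_pos hyZ, hZcard,
        shiftedSeidel_of_not_adj G q (fun h : z = y => hzY (h ▸ hy)) (hZ z hzZ y hyZ)]
      ring
    · rw [hZ.sum_shiftedSeidel_of_notMem hZcard hV hrow hsq hyZ, if_neg hyZ]
      ring
  rw [sum_congr rfl hr, sum_add_distrib, ← mul_sum, sum_add_distrib, ← mul_sum, hzs,
    ← sum_filter, filter_mem_eq_inter] at h
  simp only [sum_const, nsmul_eq_mul, hYcard, hZcard] at h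
  have hne : q * (q + 1) ≠ 0 := by positivity
  apply mul_left_cancel₀ hne
  linear_combination -h

end

theorem taylor_graph_vertex_transitive_no_delsarte_coclique {V : Type*} [Fintype V] [DecidableEq V]
    (G : SimpleGraph V) [DecidableRel G.Adj] (q k l m : ℕ) (hq : 3 < q) (hodd : Odd q)
    (hk : 2 * k = q * (q ^ 2 + 1)) (hl : 4 * l = (q - 1) * (q ^ 2 + 3))
    (hm : 4 * m = (q + 1) * (q ^ 2 + 1))
    (hsrg : G.IsSRGWith ((q + 1) * (q ^ 2 - q + 1)) k l m)
    (htrans : ∀ x y : V, ∃ φ : G ≃g G, φ x = y) :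
    ¬ ∃ Y : Finset V, IsCoclique G Y ∧ Y.card = q ^ 2 - q + 1 := by
  rintro ⟨Y, hY, hYcard⟩
  have hn : ((q ^ 2 - q + 1 : ℕ) : ℤ) = (q : ℤ) ^ 2 - q + 1 := by
    rw [Nat.cast_add, Nat.cast_sub (Nat.le_self_pow two_ne_zero q)]
    push_cast
    rfl
  have hv : (((q + 1) * (q ^ 2 - q + 1) : ℕ) : ℤ) = (q : ℤ) ^ 3 + 1 := by
    rw [Nat.cast_mul, hn]
    push_cast
    ring
  have hk' : 2 * (k : ℤ) = q * ((q : ℤ) ^ 2 + 1) := mod_cast hk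
  have hl' : 4 * (l : ℤ) = ((q : ℤ) - 1) * ((q : ℤ) ^ 2 + 3) := by
    have := congrArg (Nat.cast : ℕ → ℤ) hl
    rw [Nat.cast_mul, Nat.cast_mul, Nat.cast_sub (by omega)] at this
    exact_mod_cast this
  have hm' : 4 * (m : ℤ) = ((q : ℤ) + 1) * ((q : ℤ) ^ 2 + 1) := mod_cast hm
  have hV : (Fintype.card V : ℤ) = (q : ℤ) ^ 3 + 1 := by rw [hsrg.card, hv]
  have hYcard' : (#Y : ℤ) = (q : ℤ) ^ 2 - q + 1 := by rw [hYcard, hn]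
  have hrow : ∀ x, ∑ y, shiftedSeidel G q x y = 0 := fun x => by
    rw [sum_shiftedSeidel hsrg.regular, hV, hk']
    ring
  have hsq := sum_shiftedSeidel_mul hsrg hv hk' hl' hm'
  have hq' : (3 : ℤ) < q := mod_cast hq
  obtain ⟨x, hx⟩ : Y.Nonempty := by
    rw [← card_pos, hYcard]
    omega
  obtain ⟨z, hz⟩ : ∃ z, z ∉ Y := by
    by_contra! hall
    have h : #Y = Fintype.card V := by rw [eq_univ_of_forall hall, card_univ]
    rw [hsrg.card, hYcard] at h
    nlinarith
  obtain ⟨φ, hφ⟩ := htrans x z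
  have hZ : IsCoclique G (Y.map φ.toEquiv.toEmbedding) := by
    intro a ha b hb
    obtain ⟨a', ha', rfl⟩ := mem_map.1 ha
    obtain ⟨b', hb', rfl⟩ := mem_map.1 hb
    exact fun h => hY a' ha' b' hb' (φ.map_adj_iff.1 h)
  have key := hY.card_inter_mul (by omega) hZ hYcard' (by rw [card_map, hYcard']) hV hrow hsq
    (mem_map.2 ⟨x, hx, hφ⟩) hz
  set t : ℤ := (#(Y ∩ Y.map φ.toEquiv.toEmbedding) : ℤ)
  have hdvd : (q : ℤ) + 1 ∣ 4 := ⟨t - q + 3, by linear_combination -key⟩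
  have hle := Int.le_of_dvd (by norm_num) hdvd
  omega
end

section
/- Let q be a positive integer. If there exists a strongly regular graph Γ with parameters v = (q² + 2q − 1)(q² + 3q + 1), k = q²(q + 2), λ = 0, μ = q² (for which e⁺ = q, e⁻ = −q² − q and m⁻ = (q + 1)(q² + 2q − 1)) that possesses m⁻ + 1 = q³ + 3q² + q distinct Delsarte cocliques (cocliques of size m⁻ = q³ + 3q² + q − 1), then there exists a strongly regular graph with parameters v = q²(q + 3)², k = q³ + 3q² + q, λ = 0, μ = q² + q. -/
open Finset

/-- A function on `S` whose variance about `a` is nonpositive is constantly `a`. -/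
theorem eq_of_sum_sq_le {α : Type*} (S : Finset α) (g : α → ℤ) (a : ℤ)
    (h : ∑ x ∈ S, g x ^ 2 - 2 * a * ∑ x ∈ S, g x + #S * a ^ 2 ≤ 0) :
    ∀ x ∈ S, g x = a := by
  have key : ∑ x ∈ S, (g x - a) ^ 2 ≤ 0 := by
    refine le_trans (le_of_eq ?_) h
    simp only [sub_sq, sum_add_distrib, sum_sub_distrib, mul_sum, sum_const, nsmul_eq_mul]
    congr 2
    exact sum_congr rfl fun x _ ↦ by ring
  have h0 := (sum_eq_zero_iff_of_nonneg fun x _ ↦ sq_nonneg (g x - a)).1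
    (key.antisymm (sum_nonneg fun x _ ↦ sq_nonneg _))
  exact fun x hx ↦ sub_eq_zero.1 (pow_eq_zero_iff two_ne_zero |>.1 (h0 x hx))

section DoubleCounting

variable {α β : Type*} [Fintype α] [DecidableEq α]

theorem sum_card_filter_mem (T : Finset β) (f : β → Finset α) :
    ∑ x, (#{b ∈ T | x ∈ f b} : ℤ) = ∑ b ∈ T, (#(f b) : ℤ) := by
  simp only [card_filter, Nat.cast_sum, Nat.cast_ite, Nat.cast_one, Nat.cast_zero]
  rw [sum_comm]
  simp

theorem sum_sq_card_filter_mem (T : Finset β) (f : β → Finset α) :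
    ∑ x, (#{b ∈ T | x ∈ f b} : ℤ) ^ 2 = ∑ b ∈ T, ∑ b' ∈ T, (#(f b ∩ f b') : ℤ) := by
  simp only [card_filter, Nat.cast_sum, Nat.cast_ite, Nat.cast_one, Nat.cast_zero, sq,
    sum_mul_sum]
  rw [sum_comm]
  refine sum_congr rfl fun b _ ↦ ?_
  rw [sum_comm]
  refine sum_congr rfl fun b' _ ↦ ?_
  simp [← ite_and, ← filter_mem_eq_inter]
  congr 1
  ext x
  simp [and_comm]

theorem sum_sq_card_filter_mem_le (T : Finset β) (f : β → Finset α) {d e : ℤ}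
    (diag : ∀ b ∈ T, (#(f b) : ℤ) = d)
    (off : ∀ b ∈ T, ∀ b' ∈ T, b ≠ b' → (#(f b ∩ f b') : ℤ) ≤ e) :
    ∑ x, (#{b ∈ T | x ∈ f b} : ℤ) ^ 2 ≤ #T * (d + (#T - 1) * e) := by
  classical
  rw [sum_sq_card_filter_mem, ← nsmul_eq_mul]
  refine sum_le_card_nsmul _ _ _ fun b hb ↦ ?_
  rw [← add_sum_erase T _ hb, inter_self, diag b hb]
  gcongr
  have h := sum_le_card_nsmul (T.erase b) (fun b' ↦ (#(f b ∩ f b') : ℤ)) e fun b' hb' ↦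
    off b hb b' (mem_of_mem_erase hb') (ne_of_mem_erase hb').symm
  rwa [nsmul_eq_mul, cast_card_erase_of_mem hb] at h

theorem card_compl_cast (S : Finset α) : (#Sᶜ : ℤ) = Fintype.card α - #S := by
  rw [card_compl, Nat.cast_sub (card_le_univ S)]

end DoubleCounting

section Coclique

variable {V : Type*} [Fintype V] [DecidableEq V] {G : SimpleGraph V} [DecidableRel G.Adj]
  {v k l m : ℕ}

theorem sum_card_neighbors (h : G.IsSRGWith v k l m) (S : Finset V) :
    ∑ x, (#{b ∈ S | x ∈ G.neighborFinset b} : ℤ) = #S * k := by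
  rw [sum_card_filter_mem]
  simp [h.regular.degree_eq]

theorem IsCoclique.sum_sq_neighbors_le (h : G.IsSRGWith v k l m) {S : Finset V}
    (hS : IsCoclique G S) :
    ∑ x, (#{b ∈ S | x ∈ G.neighborFinset b} : ℤ) ^ 2 ≤ #S * (k + (#S - 1) * m) := by
  refine sum_sq_card_filter_mem_le S _ (fun b _ ↦ ?_) fun b hb b' hb' hne ↦ ?_
  · simp [h.regular.degree_eq]
  · have := h.of_not_adj hne (hS b hb b' hb')
    rw [← this, ← Set.toFinset_card]
    apply le_of_eq
    congr 2
    ext x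
    simp [SimpleGraph.mem_commonNeighbors]

theorem IsCoclique.sum_neighbors_eq_zero {S T : Finset V} (hT : IsCoclique G T) (hST : S ⊆ T) :
    ∀ x ∈ T, (#{b ∈ S | x ∈ G.neighborFinset b} : ℤ) = 0 := by
  intro x hx
  simp only [Nat.cast_eq_zero, card_eq_zero, filter_eq_empty_iff, SimpleGraph.mem_neighborFinset]
  exact fun b hb ↦ hT b (hST hb) x hx

end Coclique

section GeneralizedM22

variable {V : Type*} [Fintype V] [DecidableEq V] {G : SimpleGraph V} [DecidableRel G.Adj] {q : ℕ}

/-- Every vertex outside a Delsarte coclique has exactly `q² + q` neighbors inside it. -/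
theorem card_neighbors_in_coclique {v : ℕ}
    (hv : (v : ℤ) = (q ^ 2 + 2 * q - 1) * (q ^ 2 + 3 * q + 1))
    (h : G.IsSRGWith v (q ^ 2 * (q + 2)) 0 (q ^ 2)) {Y : Finset V} (hY : IsCoclique G Y)
    (hc : (#Y : ℤ) = q ^ 3 + 3 * q ^ 2 + q - 1) {x : V} (hx : x ∉ Y) :
    #{b ∈ Y | G.Adj x b} = q ^ 2 + q := by
  have h1 := sum_card_neighbors h Y
  have h2 := hY.sum_sq_neighbors_le h
  have h0 := hY.sum_neighbors_eq_zero subset_rfl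
  have key := eq_of_sum_sq_le Yᶜ (fun x ↦ (#{b ∈ Y | x ∈ G.neighborFinset b} : ℤ)) (q ^ 2 + q) (by
    rw [← sum_add_sum_compl Y, sum_eq_zero fun x hx ↦ h0 x hx] at h1
    rw [← sum_add_sum_compl Y, sum_eq_zero fun x hx ↦ by rw [h0 x hx]; rfl] at h2
    rw [card_compl_cast, h.card]
    rw [zero_add] at h1 h2
    rw [h1, hc, hv]
    rw [hc] at h2
    push_cast at h2 ⊢
    linarith) x (by simpa using hx)
  simp only [SimpleGraph.mem_neighborFinset, G.adj_comm _ x] at key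
  exact_mod_cast key

theorem card_inter_coclique_le (hq : 0 < q) {v : ℕ}
    (hv : (v : ℤ) = (q ^ 2 + 2 * q - 1) * (q ^ 2 + 3 * q + 1))
    (h : G.IsSRGWith v (q ^ 2 * (q + 2)) 0 (q ^ 2)) {Y Y' : Finset V} (hY : IsCoclique G Y)
    (hY' : IsCoclique G Y') (hne : Y ≠ Y') (hc : (#Y : ℤ) = q ^ 3 + 3 * q ^ 2 + q - 1)
    (hc' : (#Y' : ℤ) = q ^ 3 + 3 * q ^ 2 + q - 1) :
    (#(Y ∩ Y') : ℤ) ≤ q ^ 2 + q - 1 := by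
  have hS : IsCoclique G (Y ∩ Y') := fun x hx y hy ↦
    hY x (mem_of_mem_inter_left hx) y (mem_of_mem_inter_left hy)
  have h1 := sum_card_neighbors h (Y ∩ Y')
  have h2 := hS.sum_sq_neighbors_le h
  have h0 : ∀ x ∈ Y ∪ Y', (#{b ∈ Y ∩ Y' | x ∈ G.neighborFinset b} : ℤ) = 0 := fun x hx ↦
    (mem_union.1 hx).elim (hY.sum_neighbors_eq_zero inter_subset_left x)
      (hY'.sum_neighbors_eq_zero inter_subset_right x)
  rw [← sum_add_sum_compl (Y ∪ Y'), sum_eq_zero fun x hx ↦ h0 x hx, zero_add] at h1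
  rw [← sum_add_sum_compl (Y ∪ Y'), sum_eq_zero fun x hx ↦ by rw [h0 x hx]; rfl, zero_add] at h2
  have hcs := sq_sum_le_card_mul_sum_sq (s := (Y ∪ Y')ᶜ)
    (f := fun x ↦ (#{b ∈ Y ∩ Y' | x ∈ G.neighborFinset b} : ℤ))
  have hcard : (#(Y ∪ Y')ᶜ : ℤ) = v - 2 * (q ^ 3 + 3 * q ^ 2 + q - 1) + #(Y ∩ Y') := by
    have := card_union_add_card_inter Y Y'
    rw [card_compl_cast, h.card]
    zify at this
    linarith
  have hlt : (#(Y ∩ Y') : ℤ) < q ^ 3 + 3 * q ^ 2 + q - 1 := by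
    rw [← hc]
    refine Nat.cast_lt.2 (card_lt_card (inter_subset_left.ssubset_of_ne fun he ↦ hne ?_))
    exact eq_of_subset_of_card_le (inter_eq_left.1 he) (by zify; rw [hc, hc'])
  rw [h1] at hcs
  replace hcs := hcs.trans (mul_le_mul_of_nonneg_left h2 (Nat.cast_nonneg _))
  rw [hcard, hv] at hcs
  push_cast at hcs
  generalize (#(Y ∩ Y') : ℤ) = t at hcs hlt
  have hq' : (0 : ℤ) < q := by exact_mod_cast hq
  by_contra! hlt'
  have ht : 0 < t := by nlinarith
  have hpos : 0 < (q : ℤ) ^ 2 * t * ((t - (q ^ 2 + q - 1)) * (q ^ 3 + 3 * q ^ 2 + q - 1 - t)) := by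
    have := sub_pos.2 hlt
    have := sub_pos.2 hlt'
    positivity
  nlinarith

variable {Y : Fin (q ^ 3 + 3 * q ^ 2 + q) → Finset V}

/-- Every vertex lies in exactly `q² + q` of the cocliques. -/
theorem card_cocliques_through_vertex {v : ℕ}
    (hv : (v : ℤ) = (q ^ 2 + 2 * q - 1) * (q ^ 2 + 3 * q + 1)) (hV : Fintype.card V = v)
    (hc : ∀ i, (#(Y i) : ℤ) = q ^ 3 + 3 * q ^ 2 + q - 1)
    (hI : ∀ i j, i ≠ j → (#(Y i ∩ Y j) : ℤ) ≤ q ^ 2 + q - 1) (x : V) :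
    (#{i | x ∈ Y i} : ℤ) = q ^ 2 + q := by
  have h1 := sum_card_filter_mem univ Y
  have h2 := sum_sq_card_filter_mem_le univ Y (fun i _ ↦ hc i) fun i _ j _ ↦ hI i j
  refine eq_of_sum_sq_le univ (fun x ↦ (#{i | x ∈ Y i} : ℤ)) (q ^ 2 + q) ?_ x (mem_univ x)
  simp only [hc, sum_const, card_univ, Fintype.card_fin, nsmul_eq_mul] at h1 h2
  rw [h1, card_univ, hV, hv]
  push_cast at h2 ⊢
  linarith

theorem card_inter_coclique
    (hc : ∀ i, (#(Y i) : ℤ) = q ^ 3 + 3 * q ^ 2 + q - 1)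
    (hI : ∀ i j, i ≠ j → (#(Y i ∩ Y j) : ℤ) ≤ q ^ 2 + q - 1)
    (hr : ∀ x, (#{i | x ∈ Y i} : ℤ) = q ^ 2 + q) {i j} (hij : i ≠ j) :
    (#(Y i ∩ Y j) : ℤ) = q ^ 2 + q - 1 := by
  have h1 : ∑ j, (#(Y i ∩ Y j) : ℤ) = #(Y i) * (q ^ 2 + q) := by
    rw [← sum_card_filter_mem univ fun j ↦ Y i ∩ Y j, ← nsmul_eq_mul, ← sum_const,
      ← sum_add_sum_compl (Y i), add_eq_left.2]
    · refine sum_congr rfl fun x hx ↦ ?_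
      simp [hx, hr]
    · refine sum_eq_zero fun x hx ↦ ?_
      simp [mem_compl.1 hx]
  rw [← add_sum_erase univ _ (mem_univ i), inter_self, hc] at h1
  refine (sum_eq_sum_iff_of_le fun j hj ↦ hI i j (ne_of_mem_erase hj).symm).1 ?_ j
    (mem_erase.2 ⟨hij.symm, mem_univ j⟩)
  rw [sum_const, nsmul_eq_mul, cast_card_erase_of_mem (mem_univ i), card_univ, Fintype.card_fin]
  push_cast
  linarith

/-- Two nonadjacent vertices lie in exactly `q` common cocliques. -/
theorem card_cocliques_through_pair {v : ℕ}
    (hv : (v : ℤ) = (q ^ 2 + 2 * q - 1) * (q ^ 2 + 3 * q + 1))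
    (h : G.IsSRGWith v (q ^ 2 * (q + 2)) 0 (q ^ 2)) (hY : ∀ i, IsCoclique G (Y i))
    (hc : ∀ i, (#(Y i) : ℤ) = q ^ 3 + 3 * q ^ 2 + q - 1)
    (hI : ∀ i j, i ≠ j → (#(Y i ∩ Y j) : ℤ) ≤ q ^ 2 + q - 1)
    (hr : ∀ x, (#{i | x ∈ Y i} : ℤ) = q ^ 2 + q) {x y : V} (hxy : x ≠ y) (hadj : ¬ G.Adj x y) :
    #{i | x ∈ Y i ∧ y ∈ Y i} = q := by
  have h1 := sum_card_filter_mem {i | x ∈ Y i} Y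
  have h2 := sum_sq_card_filter_mem_le {i | x ∈ Y i} Y (fun i _ ↦ hc i) fun i _ j _ ↦ hI i j
  simp only [hc, sum_const, nsmul_eq_mul, hr] at h1 h2
  have hx : x ∉ G.neighborFinset x := by simp
  have h0 : ∀ y ∈ G.neighborFinset x, (#{i ∈ ({i | x ∈ Y i} : Finset _) | y ∈ Y i} : ℤ) = 0 := by
    intro y hy
    simp only [Nat.cast_eq_zero, card_eq_zero, filter_eq_empty_iff, mem_filter, mem_univ, true_and]
    exact fun i hi hi' ↦ hY i x hi y hi' ((G.mem_neighborFinset x y).1 hy)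
  have hxx : (#{i ∈ ({i | x ∈ Y i} : Finset _) | x ∈ Y i} : ℤ) = q ^ 2 + q := by
    rw [filter_filter]
    simpa using hr x
  rw [← sum_add_sum_compl (cons x _ hx), sum_cons, hxx, sum_eq_zero fun y hy ↦ h0 y hy] at h1
  rw [← sum_add_sum_compl (cons x _ hx), sum_cons, hxx,
    sum_eq_zero fun y hy ↦ by rw [h0 y hy]; rfl] at h2
  have key := eq_of_sum_sq_le (cons x _ hx)ᶜ
    (fun y ↦ (#{i ∈ ({i | x ∈ Y i} : Finset _) | y ∈ Y i} : ℤ)) q (by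
      rw [card_compl_cast, h.card, card_cons, SimpleGraph.card_neighborFinset_eq_degree,
        h.regular.degree_eq, hv]
      rw [← eq_sub_iff_add_eq'] at h1
      rw [h1]
      push_cast
      linarith) y (by simp [hxy.symm, hadj])
  rw [filter_filter] at key
  exact_mod_cast key

end GeneralizedM22

section Extension

variable {V I : Type*}

/-- The adjacency relation of `cocliqueExtension G Y`. -/
def CocliqueExtensionAdj (G : SimpleGraph V) (Y : I → Finset V) :
    V ⊕ Option I → V ⊕ Option I → Prop
  | .inl x, .inl y => G.Adj x y
  | .inl x, .inr (some i) => x ∈ Y i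
  | .inr (some i), .inl x => x ∈ Y i
  | .inr none, .inr (some _) => True
  | .inr (some _), .inr none => True
  | _, _ => False

/-- The extension of `G` by one vertex for each member of the family `Y`, adjacent to the elements
of that member, and one further vertex `none` adjacent to all of these. -/
@[simps]
def cocliqueExtension (G : SimpleGraph V) (Y : I → Finset V) : SimpleGraph (V ⊕ Option I) where
  Adj := CocliqueExtensionAdj G Y
  symm := ⟨by rintro (x | _ | i) (y | _ | j) <;> simp [CocliqueExtensionAdj, G.adj_comm]⟩
  loopless := ⟨by rintro (x | _ | i) <;> simp [CocliqueExtensionAdj]⟩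

theorem card_sum_option [DecidableEq V] [DecidableEq I] {S : Finset (V ⊕ Option I)}
    (A : Finset V) (B : Finset I) (hA : ∀ x, .inl x ∈ S ↔ x ∈ A)
    (hB : ∀ i, .inr (some i) ∈ S ↔ i ∈ B) :
    #S = #A + (if .inr none ∈ S then 1 else 0) + #B := by
  have hS : S = A.disjSum ((if .inr none ∈ S then {none} else ∅) ∪ B.map .some) := by
    ext (x | _ | i)
    · simp [hA]
    · by_cases h : .inr none ∈ S <;> simp [h]
    · by_cases h : .inr none ∈ S <;> simp [h, hB]
  rw [hS, card_disjSum, ← hS, card_union_of_disjoint, card_map, ← add_assoc]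
  · split_ifs <;> simp
  · split_ifs <;> simp

end Extension

theorem generalized_M22_graph_max_cocliques_implies_srg (q : ℕ) (hq : 0 < q)
    (h : ∃ (V : Type) (_ : Fintype V) (G : SimpleGraph V) (_ : DecidableRel G.Adj)
        (Y : Fin (q ^ 3 + 3 * q ^ 2 + q) → Finset V),
      G.IsSRGWith ((q ^ 2 + 2 * q - 1) * (q ^ 2 + 3 * q + 1)) (q ^ 2 * (q + 2)) 0 (q ^ 2) ∧
      Function.Injective Y ∧
      ∀ i, IsCoclique G (Y i) ∧ (Y i).card = q ^ 3 + 3 * q ^ 2 + q - 1) :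
    ∃ (W : Type) (_ : Fintype W) (H : SimpleGraph W) (_ : DecidableRel H.Adj),
      H.IsSRGWith (q ^ 2 * (q + 3) ^ 2) (q ^ 3 + 3 * q ^ 2 + q) 0 (q ^ 2 + q) := by
  classical
  obtain ⟨V, _, G, _, Y, h, hinj, hYc⟩ := h
  have hY i := (hYc i).1
  have hv : (((q ^ 2 + 2 * q - 1) * (q ^ 2 + 3 * q + 1) : ℕ) : ℤ) =
      (q ^ 2 + 2 * q - 1) * (q ^ 2 + 3 * q + 1) := by
    rw [Nat.cast_mul, Nat.cast_sub (by nlinarith)]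
    push_cast
    rfl
  have hc i : (#(Y i) : ℤ) = q ^ 3 + 3 * q ^ 2 + q - 1 := by
    rw [(hYc i).2, Nat.cast_sub (by nlinarith [pow_pos hq 3])]
    push_cast
    rfl
  have hI i j (hij : i ≠ j) : (#(Y i ∩ Y j) : ℤ) ≤ q ^ 2 + q - 1 :=
    card_inter_coclique_le hq hv h (hY i) (hY j) (hinj.ne hij) (hc i) (hc j)
  have hr := card_cocliques_through_vertex hv h.card hc hI
  have hd i x (hx : x ∉ Y i) := card_neighbors_in_coclique hv h (hY i) (hc i) hx
  have ht i j (hij : i ≠ j) := card_inter_coclique hc hI hr hij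
  have hp x y (hxy : x ≠ y) (ha : ¬ G.Adj x y) :=
    card_cocliques_through_pair hv h hY hc hI hr hxy ha
  have hcN i : #(Y i) + 1 = q ^ 3 + 3 * q ^ 2 + q := by zify; rw [hc]; ring
  have htN i j (hij : i ≠ j) : #(Y i ∩ Y j) + 1 = q ^ 2 + q := by zify; rw [ht i j hij]; ring
  have hrN x : #{i | x ∈ Y i} = q ^ 2 + q := by exact_mod_cast hr x
  have hdeg x : #{y | G.Adj x y} = q ^ 2 * (q + 2) := by
    rw [← h.regular.degree_eq x, ← G.card_neighborFinset_eq_degree]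
    congr 1
    ext y
    simp
  have hcom x y (hxy : x ≠ y) (ha : ¬ G.Adj x y) : #{z | G.Adj x z ∧ G.Adj y z} = q ^ 2 := by
    rw [← h.of_not_adj hxy ha, ← Set.toFinset_card]
    congr 1
    ext z
    simp [SimpleGraph.mem_commonNeighbors]
  have htri x y z (hxy : G.Adj x y) (hxz : G.Adj x z) : ¬ G.Adj y z := fun hyz ↦ by
    have := h.of_adj x y hxy
    rw [Fintype.card_eq_zero_iff] at this
    exact this.elim ⟨z, hxz, hyz⟩
  refine ⟨V ⊕ Option (Fin (q ^ 3 + 3 * q ^ 2 + q)), inferInstance, cocliqueExtension G Y,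
    Classical.decRel _, ⟨?_, ?_, ?_, ?_⟩⟩
  · rw [Fintype.card_sum, Fintype.card_option, Fintype.card_fin, h.card]
    zify
    push_cast at hv ⊢
    rw [hv]
    ring
  · intro w
    rw [← SimpleGraph.card_neighborFinset_eq_degree]
    rcases w with x | _ | i
    · rw [card_sum_option {y | G.Adj x y} {i | x ∈ Y i} (by simp [CocliqueExtensionAdj])
        (by simp [CocliqueExtensionAdj]), hdeg, hrN]
      simp [CocliqueExtensionAdj]
      ring
    · rw [card_sum_option ∅ univ (by simp [CocliqueExtensionAdj]) (by simp [CocliqueExtensionAdj])]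
      simp
    · rw [card_sum_option (Y i) ∅ (by simp [CocliqueExtensionAdj]) (by simp [CocliqueExtensionAdj])]
      simpa [CocliqueExtensionAdj] using hcN i
  · intro w w' hadj
    rw [Fintype.card_eq_zero_iff]
    refine ⟨?_⟩
    rintro ⟨u, hu⟩
    rw [SimpleGraph.mem_commonNeighbors] at hu
    obtain ⟨h1, h2⟩ := hu
    rcases w with x | _ | i <;> rcases w' with y | _ | j <;> rcases u with z | _ | l <;>
      simp only [cocliqueExtension_adj, CocliqueExtensionAdj] at hadj h1 h2
    · exact htri x y z hadj h1 h2
    · exact hY _ x h1 y h2 hadj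
    · exact hY _ x hadj z h2 h1
    · exact hY _ y hadj z h1 h2
  · intro w w' hne hadj
    rw [← Set.toFinset_card]
    rcases w with x | _ | i <;> rcases w' with y | _ | j <;>
      simp only [cocliqueExtension_adj, CocliqueExtensionAdj, not_true_eq_false] at hadj hne
    · have hxy : x ≠ y := fun h ↦ hne (h ▸ rfl)
      rw [card_sum_option {z | G.Adj x z ∧ G.Adj y z} {i | x ∈ Y i ∧ y ∈ Y i}
        (by simp [SimpleGraph.mem_commonNeighbors, CocliqueExtensionAdj])
        (by simp [SimpleGraph.mem_commonNeighbors, CocliqueExtensionAdj]), hcom x y hxy hadj,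
        hp x y hxy hadj]
      simp [SimpleGraph.mem_commonNeighbors, CocliqueExtensionAdj]
    · rw [card_sum_option ∅ {i | x ∈ Y i}
        (by simp [SimpleGraph.mem_commonNeighbors, CocliqueExtensionAdj])
        (by simp [SimpleGraph.mem_commonNeighbors, CocliqueExtensionAdj]), hrN]
      simp [SimpleGraph.mem_commonNeighbors, CocliqueExtensionAdj]
    · rw [card_sum_option {z ∈ Y j | G.Adj x z} ∅
        (by simp [SimpleGraph.mem_commonNeighbors, CocliqueExtensionAdj, and_comm])
        (by simp [SimpleGraph.mem_commonNeighbors, CocliqueExtensionAdj]), hd j x hadj]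
      simp [SimpleGraph.mem_commonNeighbors, CocliqueExtensionAdj]
    · rw [card_sum_option ∅ {i | y ∈ Y i}
        (by simp [SimpleGraph.mem_commonNeighbors, CocliqueExtensionAdj])
        (by simp [SimpleGraph.mem_commonNeighbors, CocliqueExtensionAdj]), hrN]
      simp [SimpleGraph.mem_commonNeighbors, CocliqueExtensionAdj]
    · exact absurd rfl hne
    · rw [card_sum_option {z ∈ Y i | G.Adj y z} ∅
        (by simp [SimpleGraph.mem_commonNeighbors, CocliqueExtensionAdj])
        (by simp [SimpleGraph.mem_commonNeighbors, CocliqueExtensionAdj]), hd i y hadj]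
      simp [SimpleGraph.mem_commonNeighbors, CocliqueExtensionAdj]
    · have hij : i ≠ j := fun h ↦ hne (h ▸ rfl)
      rw [card_sum_option (Y i ∩ Y j) ∅
        (by simp [SimpleGraph.mem_commonNeighbors, CocliqueExtensionAdj])
        (by simp [SimpleGraph.mem_commonNeighbors, CocliqueExtensionAdj]), ← htN i j hij]
      simp [SimpleGraph.mem_commonNeighbors, CocliqueExtensionAdj]
end
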